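/- Let r_1, r_2 ∈ (0,1) and let n_1, n_2 ≥ 2 be integers. The symbolic spaces Σ_{n_1}^{r_1} and Σ_{n_2}^{r_2} are bilipschitz equivalent if and only if there exist positive integers k_1, k_2 such that n_1^{k_1} = n_2^{k_2} and r_1^{k_1} = r_2^{k_2}. -/

import Mathlib

open scoped Classical

/-- The symbolic space metric on `ℕ → Fin m`: `d(x,y) = r ^ (min {k | x k ≠ y k})`
for `x ≠ y`, and `d(x,x) = 0`. -/
noncomputable def symbDist (r : ℝ) {m : ℕ} (x y : ℕ → Fin m) : ℝ :=
  if x = y then 0 else r ^ sInf {k : ℕ | x k ≠ y k}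

def symAg {n : ℕ} (x y : ℕ → Fin n) (m : ℕ) : Prop := ∀ i < m, x i = y i

theorem symAg_mono {n : ℕ} {x y : ℕ → Fin n} {m m' : ℕ} (h : symAg x y m) (hm : m' ≤ m) :
    symAg x y m' := fun i hi => h i (by omega)

theorem symb_first {n : ℕ} {x y : ℕ → Fin n} (h : x ≠ y) :
    ∃ j, (∀ r, symbDist r x y = r ^ j) ∧ ∀ m, symAg x y m ↔ m ≤ j := by
  have hne : {k : ℕ | x k ≠ y k}.Nonempty := by
    by_contra hc
    rw [Set.not_nonempty_iff_eq_empty] at hc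
    apply h
    funext k
    by_contra hk
    have : k ∈ {k : ℕ | x k ≠ y k} := hk
    rw [hc] at this
    exact this
  refine ⟨sInf {k : ℕ | x k ≠ y k}, fun r => by simp [symbDist, h], fun m => ⟨fun hm => ?_, fun hm i hi => ?_⟩⟩
  · by_contra hc
    exact Nat.sInf_mem hne (hm _ (by omega))
  · by_contra hk
    have := Nat.sInf_le (s := {k : ℕ | x k ≠ y k}) (m := i) hk
    omega

theorem symbDist_le {n : ℕ} {r : ℝ} (h0 : 0 < r) (h1 : r < 1) {x y : ℕ → Fin n} {m : ℕ}
    (h : symAg x y m) : symbDist r x y ≤ r ^ m := by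
  by_cases hxy : x = y
  · simp [symbDist, hxy]; positivity
  · obtain ⟨j, hj, hm⟩ := symb_first hxy
    rw [hj]
    exact pow_le_pow_of_le_one h0.le h1.le ((hm m).1 h)

theorem symAg_of_dist {n : ℕ} {r : ℝ} (h0 : 0 < r) (h1 : r < 1) {x y : ℕ → Fin n} {m : ℕ}
    (h : symbDist r x y ≤ r ^ m) : symAg x y m := by
  by_cases hxy : x = y
  · intro i _; rw [hxy]
  · obtain ⟨j, hj, hm⟩ := symb_first hxy
    rw [hj] at h
    exact (hm m).2 ((pow_le_pow_iff_right_of_lt_one₀ h0 h1).1 h)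

/-- Blocks -/
noncomputable def symBlk (n k : ℕ) [NeZero k] : (ℕ → Fin n) ≃ (ℕ → (Fin k → Fin n)) :=
  (Equiv.arrowCongr (Nat.divModEquiv k) (Equiv.refl _)).trans (Equiv.curry _ _ _)

theorem symBlk_ag (n k : ℕ) [NeZero k] (x y : ℕ → Fin n) (q : ℕ) :
    symAg x y (q * k) ↔ ∀ i < q, symBlk n k x i = symBlk n k y i := by
  have hk : 0 < k := Nat.pos_of_ne_zero (NeZero.ne k)
  constructor
  · intro h i hi
    funext t
    simp only [symBlk, Equiv.trans_apply, Equiv.curry_apply, Function.curry, Equiv.arrowCongr_apply, Function.comp, Equiv.refl_apply, Nat.divModEquiv_symm_apply]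
    apply h
    have := t.2
    nlinarith
  · intro h i hi
    have h1 : i / k < q := (Nat.div_lt_iff_lt_mul hk).2 hi
    have := congrFun (h _ h1) ⟨i % k, Nat.mod_lt _ hk⟩
    simp only [symBlk, Equiv.trans_apply, Equiv.curry_apply, Function.curry, Equiv.arrowCongr_apply, Function.comp, Equiv.refl_apply, Nat.divModEquiv_symm_apply] at this
    simpa [Nat.div_add_mod'] using this

theorem symb_backward
    {r₁ r₂ : ℝ} (hr₁ : r₁ ∈ Set.Ioo (0 : ℝ) 1) (hr₂ : r₂ ∈ Set.Ioo (0 : ℝ) 1)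
    {n₁ n₂ k₁ k₂ : ℕ} (hk₁ : 1 ≤ k₁) (hk₂ : 1 ≤ k₂) (hn : n₁ ^ k₁ = n₂ ^ k₂)
    (hr : r₁ ^ k₁ = r₂ ^ k₂) :
    (∃ f : (ℕ → Fin n₁) → (ℕ → Fin n₂), Function.Bijective f ∧
      ∃ C : ℝ, 1 ≤ C ∧ ∀ x y : ℕ → Fin n₁,
        C⁻¹ * symbDist r₁ x y ≤ symbDist r₂ (f x) (f y) ∧
        symbDist r₂ (f x) (f y) ≤ C * symbDist r₁ x y) := by
  have : NeZero k₁ := ⟨by omega⟩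
  have : NeZero k₂ := ⟨by omega⟩
  let e : (Fin k₁ → Fin n₁) ≃ (Fin k₂ → Fin n₂) := Fintype.equivOfCardEq (by simpa using hn)
  let F : (ℕ → Fin n₁) ≃ (ℕ → Fin n₂) :=
    (symBlk n₁ k₁).trans ((Equiv.arrowCongr (Equiv.refl ℕ) e).trans (symBlk n₂ k₂).symm)
  have hF : ∀ x y q, symAg x y (q * k₁) ↔ symAg (F x) (F y) (q * k₂) := by
    intro x y q
    rw [symBlk_ag, symBlk_ag]
    simp [F]
  obtain ⟨h10, h11⟩ := hr₁
  obtain ⟨h20, h21⟩ := hr₂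
  have hρ0 : 0 < r₁ ^ k₁ := by positivity
  have hρ1 : r₁ ^ k₁ < 1 := pow_lt_one₀ h10.le h11 (by omega)
  refine ⟨F, F.bijective, (r₁ ^ k₁)⁻¹, (one_le_inv₀ hρ0).2 hρ1.le, fun x y => ?_⟩
  by_cases hxy : x = y
  · simp [symbDist, hxy]
  obtain ⟨j, hj, hm⟩ := symb_first hxy
  obtain ⟨j', hj', hm'⟩ := symb_first (F.injective.ne hxy)
  have hq : j / k₁ = j' / k₂ := by
    have : ∀ q, q ≤ j / k₁ ↔ q ≤ j' / k₂ := by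
      intro q
      rw [Nat.le_div_iff_mul_le (by omega), Nat.le_div_iff_mul_le (by omega), ← hm, ← hm', hF]
    exact le_antisymm ((this _).1 le_rfl) ((this _).2 le_rfl)
  rw [hj, hj', inv_inv, ← div_eq_inv_mul, le_div_iff₀ hρ0]
  have a1 : r₁ ^ j ≤ (r₁ ^ k₁) ^ (j / k₁) := by
    rw [← pow_mul]; exact pow_le_pow_of_le_one h10.le h11.le (Nat.mul_div_le _ _)
  have a2 : (r₁ ^ k₁) ^ (j / k₁ + 1) ≤ r₁ ^ j := by
    rw [← pow_mul]; exact pow_le_pow_of_le_one h10.le h11.le (Nat.lt_mul_div_succ j (by omega)).le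
  have a3 : r₂ ^ j' ≤ (r₁ ^ k₁) ^ (j / k₁) := by
    rw [hr, hq, ← pow_mul]; exact pow_le_pow_of_le_one h20.le h21.le (Nat.mul_div_le _ _)
  have a4 : (r₁ ^ k₁) ^ (j / k₁ + 1) ≤ r₂ ^ j' := by
    rw [hr, hq, ← pow_mul]; exact pow_le_pow_of_le_one h20.le h21.le (Nat.lt_mul_div_succ j' (by omega)).le
  rw [pow_succ] at a2 a4
  constructor <;> nlinarith

/-- Set of prefixes of length `m` of elements of `S`. -/
noncomputable def symT {n : ℕ} (S : Set (ℕ → Fin n)) (m : ℕ) : Finset (Fin m → Fin n) :=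
  Finset.univ.filter (fun w => ∃ y ∈ S, w = fun i : Fin m => y i)

theorem mem_symT {n : ℕ} {S : Set (ℕ → Fin n)} {m : ℕ} {w : Fin m → Fin n} :
    w ∈ symT S m ↔ ∃ y ∈ S, w = fun i : Fin m => y i := by simp [symT]

theorem symT_succ_sub {n : ℕ} (S : Set (ℕ → Fin n)) (m : ℕ) :
    symT S (m + 1) ⊆ (symT S m ×ˢ (Finset.univ : Finset (Fin n))).image
      (fun p => Fin.snoc (α := fun _ => Fin n) p.1 p.2) := by
  intro w hw
  obtain ⟨y, hy, rfl⟩ := mem_symT.1 hw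
  refine Finset.mem_image.2 ⟨(fun i => y i, y m), ?_, ?_⟩
  · simp only [Finset.mem_product, Finset.mem_univ, and_true]
    exact mem_symT.2 ⟨y, hy, rfl⟩
  · have := Fin.snoc_init_self (α := fun _ => Fin n) (fun i : Fin (m+1) => y i)
    exact this

theorem symT_card_im {n : ℕ} (S : Set (ℕ → Fin n)) (m : ℕ) :
    ((symT S m ×ˢ (Finset.univ : Finset (Fin n))).image
      (fun p => Fin.snoc (α := fun _ => Fin n) p.1 p.2)).card = (symT S m).card * n := by
  rw [Finset.card_image_of_injective, Finset.card_product]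
  · simp
  · rintro ⟨a, b⟩ ⟨c, d⟩ h
    have := Fin.snoc_injective2 (α := fun _ => Fin n) h
    exact Prod.ext this.1 this.2

theorem symT_add_le {n : ℕ} (S : Set (ℕ → Fin n)) (m s : ℕ) :
    (symT S (m + s)).card ≤ (symT S m).card * n ^ s := by
  induction s with
  | zero => simp
  | succ s ih =>
    have := Finset.card_le_card (symT_succ_sub S (m + s))
    rw [symT_card_im] at this
    rw [← add_assoc, pow_succ, ← mul_assoc]
    exact this.trans (Nat.mul_le_mul_right _ ih)

theorem symT_succ_eq {n : ℕ} (S : Set (ℕ → Fin n)) (m : ℕ)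
    (hS : ∀ y ∈ S, ∀ z, symAg y z m → z ∈ S) :
    (symT S (m + 1)).card = (symT S m).card * n := by
  rw [← symT_card_im]
  congr 1
  apply subset_antisymm (symT_succ_sub S m)
  intro w hw
  obtain ⟨⟨a, b⟩, hp, rfl⟩ := Finset.mem_image.1 hw
  simp only [Finset.mem_product, Finset.mem_univ, and_true] at hp
  obtain ⟨y, hy, rfl⟩ := mem_symT.1 hp
  refine mem_symT.2 ⟨Function.update y m b, hS y hy _ ?_, ?_⟩
  · intro i hi
    rw [Function.update_of_ne (by omega)]
  · funext i
    refine Fin.lastCases ?_ (fun i => ?_) i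
    · simp
    · have := i.2
      simp only [Fin.snoc_castSucc, Fin.val_castSucc]
      rw [Function.update_of_ne (by omega)]

theorem symT_add_eq {n : ℕ} (S : Set (ℕ → Fin n)) (m s : ℕ)
    (hS : ∀ y ∈ S, ∀ z, symAg y z m → z ∈ S) :
    (symT S (m + s)).card = (symT S m).card * n ^ s := by
  induction s with
  | zero => simp
  | succ s ih =>
    rw [← add_assoc, symT_succ_eq, ih, pow_succ, mul_assoc]
    exact fun y hy z hz => hS y hy z (symAg_mono hz (by omega))

/-- cylinder image -/
def symIm {n₁ n₂ : ℕ} (f : (ℕ → Fin n₁) → (ℕ → Fin n₂)) (x : ℕ → Fin n₁) (j : ℕ) :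
    Set (ℕ → Fin n₂) := f '' {y | symAg x y j}

/-- count -/
noncomputable def symA {n₁ n₂ : ℕ} (f : (ℕ → Fin n₁) → (ℕ → Fin n₂)) (L : ℕ → ℕ)
    (x : ℕ → Fin n₁) (j : ℕ) : ℕ := (symT (symIm f x j) (L j)).card

/-- density -/
noncomputable def symG {n₁ n₂ : ℕ} (f : (ℕ → Fin n₁) → (ℕ → Fin n₂)) (L : ℕ → ℕ)
    (x : ℕ → Fin n₁) (j : ℕ) : ℝ := symA f L x j * (n₁ : ℝ) ^ j / (n₂ : ℝ) ^ (L j)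

theorem symA_pos {n₁ n₂ : ℕ} (f : (ℕ → Fin n₁) → (ℕ → Fin n₂)) (L : ℕ → ℕ)
    (x : ℕ → Fin n₁) (j : ℕ) : 1 ≤ symA f L x j :=
  Finset.card_pos.2 ⟨_, mem_symT.2 ⟨f x, ⟨x, fun _ _ => rfl, rfl⟩, rfl⟩⟩

theorem symA_le {n₁ n₂ : ℕ} (hn₂ : 2 ≤ n₂) (f : (ℕ → Fin n₁) → (ℕ → Fin n₂)) (L : ℕ → ℕ) (Q : ℕ)
    (H2 : ∀ x y j, symAg x y j → symAg (f x) (f y) (L j - Q))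
    (x : ℕ → Fin n₁) (j : ℕ) : symA f L x j ≤ n₂ ^ Q := by
  have h1 : (symT (symIm f x j) (L j - Q)).card ≤ 1 := by
    rw [Finset.card_le_one]
    intro a ha b hb
    obtain ⟨_, ⟨y, hy, rfl⟩, rfl⟩ := mem_symT.1 ha
    obtain ⟨_, ⟨z, hz, rfl⟩, rfl⟩ := mem_symT.1 hb
    funext i
    rw [← H2 x y j hy i i.2, ← H2 x z j hz i i.2]
  have h2 := symT_add_le (symIm f x j) (L j - Q) (L j - (L j - Q))
  rw [show L j - Q + (L j - (L j - Q)) = L j by omega] at h2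
  calc symA f L x j ≤ _ := h2
    _ ≤ 1 * n₂ ^ Q := Nat.mul_le_mul h1 (Nat.pow_le_pow_right (by omega) (by omega))
    _ = _ := one_mul _

theorem symA_sum {n₁ n₂ : ℕ} (f : (ℕ → Fin n₁) → (ℕ → Fin n₂)) (hf : Function.Surjective f)
    (L : ℕ → ℕ) (hL : Monotone L)
    (H1 : ∀ x y j, symAg (f x) (f y) (L j) → symAg x y j)
    (x : ℕ → Fin n₁) (j : ℕ) :
    ∑ i : Fin n₁, symA f L (Function.update x j i) (j + 1) =
      symA f L x j * n₂ ^ (L (j + 1) - L j) := by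
  have hup : ∀ i y, symAg (Function.update x j i) y (j+1) ↔ symAg x y j ∧ y j = i := by
    intro i y
    constructor
    · intro h
      refine ⟨fun k hk => ?_, ?_⟩
      · have := h k (by omega)
        rwa [Function.update_of_ne (by omega)] at this
      · have := h j (by omega)
        simpa using this.symm
    · rintro ⟨h, h'⟩ k hk
      by_cases hkj : k = j
      · subst hkj; simp [h']
      · rw [Function.update_of_ne hkj]; exact h k (by omega)
  unfold symA
  rw [← symT_add_eq, Nat.add_sub_cancel' (hL (Nat.le_succ j)), ← Finset.card_biUnion]
  · congr 1
    ext w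
    simp only [Finset.mem_biUnion, Finset.mem_univ, true_and, mem_symT]
    constructor
    · rintro ⟨i, _, ⟨y, hy, rfl⟩, rfl⟩
      exact ⟨_, ⟨y, ((hup i y).1 hy).1, rfl⟩, rfl⟩
    · rintro ⟨_, ⟨y, hy, rfl⟩, rfl⟩
      exact ⟨y j, _, ⟨y, (hup _ y).2 ⟨hy, rfl⟩, rfl⟩, rfl⟩
  · intro i _ i' _ hii
    rw [Function.onFun, Finset.disjoint_left]
    intro w hw hw'
    obtain ⟨_, ⟨y, hy, rfl⟩, rfl⟩ := mem_symT.1 hw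
    obtain ⟨_, ⟨z, hz, rfl⟩, he⟩ := mem_symT.1 hw'
    apply hii
    rw [← ((hup i y).1 hy).2, ← ((hup i' z).1 hz).2]
    exact H1 y z (j+1) (fun k hk => congrFun he ⟨k, hk⟩) j (by omega)
  · rintro _ ⟨y, hy, rfl⟩ z hz
    obtain ⟨z, rfl⟩ := hf z
    exact ⟨z, fun k hk => (hy k hk).trans (H1 y z j hz k hk), rfl⟩

theorem symG_sum {n₁ n₂ : ℕ} (hn₂ : 2 ≤ n₂) (f : (ℕ → Fin n₁) → (ℕ → Fin n₂))
    (hf : Function.Surjective f)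
    (L : ℕ → ℕ) (hL : Monotone L)
    (H1 : ∀ x y j, symAg (f x) (f y) (L j) → symAg x y j)
    (x : ℕ → Fin n₁) (j : ℕ) :
    ∑ i : Fin n₁, symG f L (Function.update x j i) (j + 1) = n₁ * symG f L x j := by
  have h := congrArg (Nat.cast (R := ℝ)) (symA_sum f hf L hL H1 x j)
  push_cast at h
  unfold symG
  rw [← Finset.sum_div, ← Finset.sum_mul, h]
  have hn : (n₂ : ℝ) ≠ 0 := by positivity
  have : (n₂ : ℝ) ^ L (j+1) = n₂ ^ L j * n₂ ^ (L (j+1) - L j) := by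
    rw [← pow_add, Nat.add_sub_cancel' (hL (Nat.le_succ j))]
  rw [this]
  field_simp
  ring

theorem symG_le {n₁ n₂ : ℕ} (hn₁ : 2 ≤ n₁) (hn₂ : 2 ≤ n₂) (f : (ℕ → Fin n₁) → (ℕ → Fin n₂))
    (L : ℕ → ℕ) (Q : ℕ)
    (H1 : ∀ x y j, symAg (f x) (f y) (L j) → symAg x y j)
    (H2 : ∀ x y j, symAg x y j → symAg (f x) (f y) (L j - Q))
    (x : ℕ → Fin n₁) (j : ℕ) : symG f L x j ≤ (n₂ : ℝ) ^ Q := by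
  have h1 : n₁ ^ j ≤ n₂ ^ L j := by
    let ex : (Fin j → Fin n₁) → (ℕ → Fin n₁) := fun w i => if h : i < j then w ⟨i, h⟩ else ⟨0, by omega⟩
    have := Fintype.card_le_of_injective
      (fun (w : Fin j → Fin n₁) => fun i : Fin (L j) => f (ex w) i) (by
        intro w w' h
        have := H1 (ex w) (ex w') j (fun k hk => congrFun h ⟨k, hk⟩)
        funext i
        simpa [ex] using this i i.2)
    simpa using this
  have h2 := symA_le hn₂ f L Q H2 x j
  unfold symG
  rw [div_le_iff₀ (by positivity)]
  exact_mod_cast Nat.mul_le_mul h2 h1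

theorem symG_gap {n₁ n₂ : ℕ} (hn₁ : 2 ≤ n₁) (hn₂ : 2 ≤ n₂) (f : (ℕ → Fin n₁) → (ℕ → Fin n₂))
    (L : ℕ → ℕ) (hL : Monotone L) (Q t : ℕ) (hLt : ∀ j, L (j+1) ≤ L j + t)
    (H2 : ∀ x y j, symAg x y j → symAg (f x) (f y) (L j - Q))
    (x y : ℕ → Fin n₁) (j : ℕ)
    (h : symG f L y (j + 1) < (1 + 1 / (n₂ : ℝ) ^ (Q + t)) * symG f L x j) :
    symG f L y (j + 1) ≤ symG f L x j := by
  have hn : (0 : ℝ) < n₂ := by positivity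
  have hn1 : (0 : ℝ) < n₁ := by positivity
  obtain ⟨s, hs⟩ : ∃ s, L (j+1) = L j + s := ⟨_, (Nat.add_sub_cancel' (hL (Nat.le_succ j))).symm⟩
  have hst : s ≤ t := by have := hLt j; omega
  have ha := symA_le hn₂ f L Q H2 x j
  unfold symG at h ⊢
  set a := symA f L x j
  set b := symA f L y (j+1)
  rw [hs, pow_add (n₂ : ℝ) (L j) s, pow_succ (n₁ : ℝ) j] at h ⊢
  have e1 : (b : ℝ) * ((n₁ : ℝ) ^ j * n₁) / (n₂ ^ L j * n₂ ^ s) =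
    (b * n₁ / n₂ ^ s) * (n₁ ^ j / n₂ ^ L j) := by field_simp
  have e2 : (a : ℝ) * (n₁ : ℝ) ^ j / (n₂ ^ L j) = a * (n₁ ^ j / n₂ ^ L j) := by ring
  have hc : (0 : ℝ) < n₁ ^ j / n₂ ^ L j := by positivity
  rw [e1, e2] at h ⊢
  rw [← mul_assoc] at h
  have h := lt_of_mul_lt_mul_right h hc.le
  apply mul_le_mul_of_nonneg_right _ hc.le
  rw [div_lt_iff₀ (by positivity)] at h
  rw [div_le_iff₀ (by positivity)]
  have h3 : a * n₂ ^ s ≤ n₂ ^ (Q + t) := by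
    rw [pow_add]; exact Nat.mul_le_mul ha (Nat.pow_le_pow_right (by omega) hst)
  have h3' : (a : ℝ) * n₂ ^ s / n₂ ^ (Q + t) ≤ 1 := by
    rw [div_le_one (by positivity)]; exact_mod_cast h3
  have h4 : (b : ℝ) * n₁ < a * n₂ ^ s + 1 := by
    calc (b : ℝ) * n₁ < _ := h
      _ = a * n₂ ^ s + (a : ℝ) * n₂ ^ s / n₂ ^ (Q + t) := by ring
      _ ≤ _ := by linarith
  have h5 : b * n₁ < a * n₂ ^ s + 1 := by exact_mod_cast h4
  exact_mod_cast Nat.lt_succ_iff.1 h5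

theorem sym_core {n₁ n₂ : ℕ} (hn₁ : 2 ≤ n₁) (hn₂ : 2 ≤ n₂) (f : (ℕ → Fin n₁) → (ℕ → Fin n₂))
    (hf : Function.Surjective f)
    (L : ℕ → ℕ) (hL : Monotone L) (Q t : ℕ) (hLt : ∀ j, L (j+1) ≤ L j + t)
    (H1 : ∀ x y j, symAg (f x) (f y) (L j) → symAg x y j)
    (H2 : ∀ x y j, symAg x y j → symAg (f x) (f y) (L j - Q)) :
    ∃ J : Set ℕ, J.Infinite ∧ ∀ i ∈ J, ∀ j ∈ J, i < j → n₁ ^ (j - i) = n₂ ^ (L j - L i) := by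
  have hn : (0 : ℝ) < n₂ := by positivity
  have hn1 : (0 : ℝ) < n₁ := by positivity
  have hGpos : ∀ x j, 0 < symG f L x j := by
    intro x j
    have := symA_pos f L x j
    unfold symG
    positivity
  set δ : ℝ := 1 / (n₂ : ℝ) ^ (Q + t) with hδ
  have hδ0 : 0 < δ := by positivity
  -- existence of an almost maximal cylinder
  have key : ∃ x j, ∀ y k, symAg x y j → symG f L y (j + k) < (1 + δ) * symG f L x j := by
    by_contra hc
    push Not at hc
    have x0 : ℕ → Fin n₁ := fun _ => ⟨0, by omega⟩
    have : ∀ N : ℕ, ∃ x j, (1 + δ) ^ N * symG f L x0 0 ≤ symG f L x j := by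
      intro N
      induction N with
      | zero => exact ⟨x0, 0, by simp⟩
      | succ N ih =>
        obtain ⟨x, j, h⟩ := ih
        obtain ⟨y, k, -, h'⟩ := hc x j
        refine ⟨y, j + k, le_trans ?_ h'⟩
        rw [pow_succ', mul_assoc]
        exact mul_le_mul_of_nonneg_left h (by positivity)
    obtain ⟨N, hN⟩ := pow_unbounded_of_one_lt ((n₂ : ℝ) ^ Q / symG f L x0 0) (show 1 < 1 + δ by linarith)
    obtain ⟨x, j, h⟩ := this N
    rw [div_lt_iff₀ (hGpos _ _)] at hN
    have := symG_le hn₁ hn₂ f L Q H1 H2 x j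
    linarith
  obtain ⟨x, j₀, hx⟩ := key
  have hconst : ∀ k y, symAg x y j₀ → symG f L y (j₀ + k) = symG f L x j₀ := by
    intro k
    induction k with
    | zero =>
      intro y hy
      have : symIm f y j₀ = symIm f x j₀ := by
        unfold symIm
        congr 1
        ext z
        exact ⟨fun h i hi => (hy i hi).trans (h i hi), fun h i hi => (hy i hi).symm.trans (h i hi)⟩
      simp [symG, symA, this]
    | succ k ih =>
      intro y hy
      have hu : ∀ i, symAg x (Function.update y (j₀ + k) i) j₀ := by
        intro i l hl
        rw [Function.update_of_ne (by omega)]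
        exact hy l hl
      have hle : ∀ i ∈ (Finset.univ : Finset (Fin n₁)),
          symG f L (Function.update y (j₀ + k) i) (j₀ + k + 1) ≤ symG f L y (j₀ + k) := by
        intro i _
        apply symG_gap hn₁ hn₂ f L hL Q t hLt H2
        rw [ih y hy]
        exact hx _ (k+1) (hu i)
      have hs := symG_sum hn₂ f hf L hL H1 y (j₀ + k)
      have h2 := (Finset.sum_eq_sum_iff_of_le hle).1 (by rw [hs]; simp) (y (j₀ + k)) (Finset.mem_univ _)
      rw [Function.update_eq_self] at h2
      rw [← add_assoc, h2, ih y hy]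
  -- pigeonhole
  let φ : ℕ → Fin (n₂ ^ Q + 1) := fun k => ⟨symA f L x (j₀ + k), Nat.lt_succ_iff.2 (symA_le hn₂ f L Q H2 x _)⟩
  obtain ⟨v, hv⟩ := Finite.exists_infinite_fiber φ
  refine ⟨(fun k => j₀ + k) '' (φ ⁻¹' {v}), (Set.infinite_coe_iff.1 hv).image (by intro a _ b _ h; simpa using h), ?_⟩
  rintro _ ⟨i, hi, rfl⟩ _ ⟨j, hj, rfl⟩ hij
  have hA : symA f L x (j₀ + i) = symA f L x (j₀ + j) := by
    have : φ i = φ j := by rw [Set.mem_preimage.1 hi, Set.mem_preimage.1 hj]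
    simpa [φ] using this
  have hG := (hconst i x (fun _ _ => rfl)).trans (hconst j x (fun _ _ => rfl)).symm
  unfold symG at hG
  have hpos := symA_pos f L x (j₀ + j)
  rw [hA] at hG
  have hApos : (0 : ℝ) < symA f L x (j₀ + j) := by exact_mod_cast hpos
  simp only at hij ⊢
  generalize j₀ + i = i at *
  generalize j₀ + j = j at *
  have e1 : (n₁ : ℝ) ^ j = n₁ ^ i * n₁ ^ (j - i) := by rw [← pow_add]; congr 1; omega
  have e2 : (n₂ : ℝ) ^ L j = n₂ ^ L i * n₂ ^ (L j - L i) := by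
    rw [← pow_add, Nat.add_sub_cancel' (hL hij.le)]
  rw [e1, e2] at hG
  have : (n₁ : ℝ) ^ (j - i) = n₂ ^ (L j - L i) := by
    field_simp at hG
    linarith
  exact_mod_cast this

theorem symb_forward
    {r₁ r₂ : ℝ} (hr₁ : r₁ ∈ Set.Ioo (0 : ℝ) 1) (hr₂ : r₂ ∈ Set.Ioo (0 : ℝ) 1)
    {n₁ n₂ : ℕ} (hn₁ : 2 ≤ n₁) (hn₂ : 2 ≤ n₂) (f : (ℕ → Fin n₁) → (ℕ → Fin n₂))
    (hf : Function.Bijective f) (C : ℝ) (hC : 1 ≤ C) (hd : ∀ x y : ℕ → Fin n₁,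
        C⁻¹ * symbDist r₁ x y ≤ symbDist r₂ (f x) (f y) ∧
        symbDist r₂ (f x) (f y) ≤ C * symbDist r₁ x y) :
    ∃ k₁ k₂ : ℕ, 1 ≤ k₁ ∧ 1 ≤ k₂ ∧ n₁ ^ k₁ = n₂ ^ k₂ ∧ r₁ ^ k₁ = r₂ ^ k₂ := by
  obtain ⟨h10, h11⟩ := hr₁
  obtain ⟨h20, h21⟩ := hr₂
  have hC0 : 0 < C := by linarith
  have hex : ∀ j, ∃ m, C * r₂ ^ m < r₁ ^ j := by
    intro j
    obtain ⟨m, hm⟩ := exists_pow_lt_of_lt_one (show 0 < r₁ ^ j / C by positivity) h21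
    exact ⟨m, by rwa [lt_div_iff₀' hC0] at hm⟩
  let L : ℕ → ℕ := fun j => Nat.find (hex j)
  have hLs : ∀ j, C * r₂ ^ L j < r₁ ^ j := fun j => Nat.find_spec (hex j)
  have hLle : ∀ j m, C * r₂ ^ m < r₁ ^ j → L j ≤ m := fun j m h => Nat.find_min' (hex j) h
  have hL1 : ∀ j, 1 ≤ L j := by
    intro j
    by_contra hc
    have h := hLs j
    rw [show L j = 0 by omega, pow_zero, mul_one] at h
    have := pow_le_one₀ (n := j) h10.le h11.le
    linarith
  have hLlow : ∀ j, r₁ ^ j * r₂ ≤ C * r₂ ^ L j := by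
    intro j
    obtain ⟨m, hm⟩ : ∃ m, L j = m + 1 := ⟨L j - 1, by have := hL1 j; omega⟩
    have : r₁ ^ j ≤ C * r₂ ^ m := by
      by_contra hc
      have := hLle j m (not_le.1 hc)
      omega
    rw [hm, pow_succ, ← mul_assoc]
    exact mul_le_mul_of_nonneg_right this h20.le
  have hL : Monotone L := by
    intro i j hij
    exact hLle i _ ((hLs j).trans_le (pow_le_pow_of_le_one h10.le h11.le hij))
  obtain ⟨t, ht⟩ := exists_pow_lt_of_lt_one h10 h21
  have hLt : ∀ j, L (j+1) ≤ L j + t := by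
    intro j
    apply hLle
    rw [pow_add, pow_succ, ← mul_assoc]
    exact mul_lt_mul (hLs j) ht.le (by positivity) (by positivity)
  obtain ⟨Q, hQ⟩ := exists_pow_lt_of_lt_one (show 0 < r₂ / C ^ 2 by positivity) h21
  rw [lt_div_iff₀ (by positivity)] at hQ
  have H1 : ∀ x y j, symAg (f x) (f y) (L j) → symAg x y j := by
    intro x y j h
    apply symAg_of_dist h10 h11
    have h1 := symbDist_le h20 h21 h
    have h2 := (hd x y).1
    rw [inv_mul_le_iff₀ hC0] at h2
    have h3 := mul_le_mul_of_nonneg_left h1 hC0.le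
    linarith [hLs j]
  have H2 : ∀ x y j, symAg x y j → symAg (f x) (f y) (L j - Q) := by
    intro x y j h
    by_cases hq : L j ≤ Q
    · rw [Nat.sub_eq_zero_of_le hq]; intro i hi; omega
    apply symAg_of_dist h20 h21
    have h1 := symbDist_le h10 h11 h
    have h2 := (hd x y).2
    have h3 := mul_le_mul_of_nonneg_left h1 hC0.le
    refine h2.trans (h3.trans ?_)
    have h4 := hLlow j
    obtain ⟨p, hp⟩ : ∃ p, L j = p + Q := ⟨L j - Q, by omega⟩
    rw [hp, Nat.add_sub_cancel]
    rw [hp, pow_add] at h4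
    have h5 : 0 < r₂ ^ p := by positivity
    have h6 : (C * r₁ ^ j) * r₂ ≤ r₂ ^ p * r₂ := by
      calc (C * r₁ ^ j) * r₂ = C * (r₁ ^ j * r₂) := by ring
        _ ≤ C * (C * (r₂ ^ p * r₂ ^ Q)) := mul_le_mul_of_nonneg_left h4 hC0.le
        _ = r₂ ^ p * (r₂ ^ Q * C ^ 2) := by ring
        _ ≤ _ := mul_le_mul_of_nonneg_left hQ.le h5.le
    exact le_of_mul_le_mul_right h6 h20
  obtain ⟨J, hJ, hJe⟩ := sym_core hn₁ hn₂ f hf.2 L hL Q t hLt H1 H2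
  obtain ⟨i₀, hi₀⟩ := hJ.nonempty
  obtain ⟨i₁, hi₁, h01⟩ := hJ.exists_gt i₀
  have hk := hJe i₀ hi₀ i₁ hi₁ h01
  have hk2 : 1 ≤ L i₁ - L i₀ := by
    by_contra hc
    rw [show L i₁ - L i₀ = 0 by omega, pow_zero] at hk
    have := Nat.one_lt_pow (show i₁ - i₀ ≠ 0 by omega) (show 1 < n₁ by omega)
    omega
  refine ⟨i₁ - i₀, L i₁ - L i₀, by omega, hk2, hk, ?_⟩
  set k₁ := i₁ - i₀ with hk₁
  set k₂ := L i₁ - L i₀ with hk₂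
  have hk1pos : (0:ℝ) < k₁ := by
    have : 0 < k₁ := by omega
    exact_mod_cast this
  have hlog : ∀ a b : ℕ, n₁ ^ a = n₂ ^ b → (a : ℝ) * Real.log n₁ = b * Real.log n₂ := by
    intro a b h
    rw [← Real.log_pow, ← Real.log_pow]
    congr 1
    exact_mod_cast h
  have hb : 0 < Real.log n₂ := Real.log_pos (by exact_mod_cast (show 1 < n₂ by omega))
  set K : ℝ := Real.log C - Real.log r₂ with hK
  have hbd : ∀ j : ℕ, |(j : ℝ) * Real.log r₁ - L j * Real.log r₂| ≤ K := by
    intro j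
    have h1 := Real.log_le_log (by positivity) (hLs j).le
    have h2 := Real.log_le_log (by positivity) (hLlow j)
    rw [Real.log_mul (by positivity) (by positivity), Real.log_pow, Real.log_pow] at h1
    rw [Real.log_mul (by positivity) (by positivity), Real.log_mul (by positivity) (by positivity), Real.log_pow, Real.log_pow] at h2
    have h3 := Real.log_nonneg hC
    have h4 := Real.log_neg h20 h21
    rw [abs_le]
    constructor <;> linarith
  set D : ℝ := k₁ * Real.log r₁ - k₂ * Real.log r₂ with hD
  have hD0 : D = 0 := by
    by_contra hne
    have hDpos : 0 < |D| := abs_pos.2 hne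
    obtain ⟨M, hM⟩ := exists_nat_gt (2 * k₁ * K / |D|)
    obtain ⟨j, hj, hjM⟩ := hJ.exists_gt (M + i₀)
    have hji : i₀ < j := by omega
    have e := hlog _ _ (hJe i₀ hi₀ j hj hji)
    have e' := hlog _ _ hk
    rw [Nat.cast_sub hji.le, Nat.cast_sub (hL hji.le)] at e
    have e3 : (k₁ : ℝ) * (L j - L i₀) = k₂ * (j - i₀) := by
      have : ((k₁ : ℝ) * (L j - L i₀)) * Real.log n₂ = (k₂ * (j - i₀)) * Real.log n₂ := by
        linear_combination (j - i₀ : ℝ) * e' - (k₁ : ℝ) * e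
      exact mul_right_cancel₀ hb.ne' this
    have e4 : ((j : ℝ) - i₀) * D = k₁ * ((j * Real.log r₁ - L j * Real.log r₂) -
        (i₀ * Real.log r₁ - L i₀ * Real.log r₂)) := by
      rw [hD]; linear_combination (Real.log r₂) * e3
    have hMj : (M : ℝ) ≤ j - i₀ := by
      have : ((M + i₀ : ℕ) : ℝ) ≤ j := by exact_mod_cast hjM.le
      push_cast at this; linarith
    have hM0 : (0 : ℝ) ≤ M := Nat.cast_nonneg M
    have e5 : ((j : ℝ) - i₀) * |D| ≤ k₁ * (K + K) := by
      rw [← abs_of_nonneg (hM0.trans hMj), ← abs_mul, e4, abs_mul, abs_of_pos hk1pos]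
      exact mul_le_mul_of_nonneg_left ((abs_sub _ _).trans (add_le_add (hbd j) (hbd i₀))) hk1pos.le
    rw [div_lt_iff₀ hDpos] at hM
    nlinarith
  apply Real.log_injOn_pos (Set.mem_Ioi.2 (by positivity)) (Set.mem_Ioi.2 (by positivity))
  rw [Real.log_pow, Real.log_pow]
  linarith

/-- **Lemma (Cooper–Pignataro, Falconer–Marsh).** For `r₁, r₂ ∈ (0,1)` and
integers `n₁, n₂ ≥ 2`, the symbolic spaces `Σ_{n₁}^{r₁}` and `Σ_{n₂}^{r₂}` are
bilipschitz equivalent iff there are `k₁, k₂ ∈ ℕ`, `k₁, k₂ ≥ 1`, with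
`n₁^{k₁} = n₂^{k₂}` and `r₁^{k₁} = r₂^{k₂}`. -/
theorem symb_bilip_iff
    {r₁ r₂ : ℝ} (hr₁ : r₁ ∈ Set.Ioo (0 : ℝ) 1) (hr₂ : r₂ ∈ Set.Ioo (0 : ℝ) 1)
    {n₁ n₂ : ℕ} (hn₁ : 2 ≤ n₁) (hn₂ : 2 ≤ n₂) :
    (∃ f : (ℕ → Fin n₁) → (ℕ → Fin n₂), Function.Bijective f ∧
      ∃ C : ℝ, 1 ≤ C ∧ ∀ x y : ℕ → Fin n₁,
        C⁻¹ * symbDist r₁ x y ≤ symbDist r₂ (f x) (f y) ∧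
        symbDist r₂ (f x) (f y) ≤ C * symbDist r₁ x y) ↔
    ∃ k₁ k₂ : ℕ, 1 ≤ k₁ ∧ 1 ≤ k₂ ∧ n₁ ^ k₁ = n₂ ^ k₂ ∧ r₁ ^ k₁ = r₂ ^ k₂ := by
  constructor
  · rintro ⟨f, hf, C, hC, hd⟩
    exact symb_forward hr₁ hr₂ hn₁ hn₂ f hf C hC hd
  · rintro ⟨k₁, k₂, hk₁, hk₂, hn, hr⟩
    exact symb_backward hr₁ hr₂ hk₁ hk₂ hn hr
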